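/- arXiv:2411.11085 — 2 statements merged into one kernel-verified Lean document; each statement's English description precedes it below -/
import Mathlib

section
/- Let n, k be positive integers and let A_1, …, A_k be n×n integer matrices. Let C be the nk×nk block matrix with k×k blocks of size n×n, where the (i,i) block equals A_i for 1 ≤ i ≤ k, the (i+1,i) block equals the n×n identity matrix I for 1 ≤ i ≤ k−1, and all other blocks are zero. Then cok(C) is isomorphic (as an abelian group) to cok(A_1 A_2 ⋯ A_k). -/
open scoped Classical

noncomputable section

/-- The cokernel of a square integer matrix: `ℤ^ι` modulo the subgroup generated by the rows. -/
abbrev cok {ι : Type*} (M : Matrix ι ι ℤ) : Type _ :=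
  (ι → ℤ) ⧸ AddSubgroup.closure (Set.range fun i => M i)

/-- The subgroup generated by the rows of `M` consists of the vectors `w ᵥ* M`. -/
theorem mem_closure_range_rows_iff {ι : Type*} [Fintype ι] (M : Matrix ι ι ℤ) (x : ι → ℤ) :
    x ∈ AddSubgroup.closure (Set.range fun i => M i) ↔ ∃ w : ι → ℤ, Matrix.vecMul w M = x := by
  rw [← Submodule.span_int_eq_addSubgroupClosure, Submodule.mem_toAddSubgroup]
  rw [Submodule.mem_span_range_iff_exists_fun]
  simp only [Matrix.vecMul_eq_sum]

/-- Forward substitution for the equations `w i ᵥ* A i + w (i + 1) = v i` with `w 0 = z`. -/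
def forwardSubst {ι : Type*} [Fintype ι] (A : ℕ → Matrix ι ι ℤ) (z : ι → ℤ) (v : ℕ → ι → ℤ) :
    ℕ → ι → ℤ
  | 0 => z
  | i + 1 => v i - Matrix.vecMul (forwardSubst A z v i) (A i)

theorem forwardSubst_add {ι : Type*} [Fintype ι] (A : ℕ → Matrix ι ι ℤ) (z z' : ι → ℤ)
    (v v' : ℕ → ι → ℤ) (j : ℕ) :
    forwardSubst A (z + z') (v + v') j = forwardSubst A z v j + forwardSubst A z' v' j := by
  induction j with
  | zero => rfl
  | succ j ih =>
    simp only [forwardSubst, ih, Matrix.add_vecMul, Pi.add_apply]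
    abel

theorem forwardSubst_zero_right {ι : Type*} [Fintype ι] [DecidableEq ι]
    (A : ℕ → Matrix ι ι ℤ) (z : ι → ℤ) (j : ℕ) :
    forwardSubst A z 0 j = Matrix.vecMul ((-1 : ℤ) ^ j • z) ((List.range j).map A).prod := by
  induction j with
  | zero => simp [forwardSubst]
  | succ j ih =>
    simp [forwardSubst, ih, List.prod_range_succ, Matrix.vecMul_vecMul, pow_succ,
      Matrix.neg_vecMul]

theorem forwardSubst_eq {ι : Type*} [Fintype ι] [DecidableEq ι]
    (A : ℕ → Matrix ι ι ℤ) (z : ι → ℤ) (v : ℕ → ι → ℤ) (j : ℕ) :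
    forwardSubst A z v j =
      forwardSubst A 0 v j + Matrix.vecMul ((-1 : ℤ) ^ j • z) ((List.range j).map A).prod := by
  rw [← forwardSubst_zero_right, ← forwardSubst_add, zero_add, add_zero]

/-- If `w` satisfies the first `k` equations, it agrees with forward substitution up to `k`. -/
theorem eq_forwardSubst {ι : Type*} [Fintype ι] (A : ℕ → Matrix ι ι ℤ) (v w : ℕ → ι → ℤ) (k : ℕ)
    (h : ∀ i < k, Matrix.vecMul (w i) (A i) + w (i + 1) = v i) :
    ∀ j ≤ k, w j = forwardSubst A (w 0) v j := by
  intro j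
  induction j with
  | zero => intro _; rfl
  | succ j ih =>
    intro hj
    rw [forwardSubst, ← ih (by omega), ← h j hj, add_sub_cancel_left]

/-- The blocks of a vector, extended by zero. -/
def blockExtend {k : ℕ} {ι : Type*} (v : Fin k × ι → ℤ) (i : ℕ) : ι → ℤ :=
  if h : i < k then fun b => v (⟨i, h⟩, b) else 0

theorem blockExtend_add {k : ℕ} {ι : Type*} (v w : Fin k × ι → ℤ) :
    blockExtend (v + w) = blockExtend v + blockExtend w := by
  funext i
  by_cases h : i < k
  · simp [blockExtend, h]
    rfl
  · simp [blockExtend, h]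

theorem blockExtend_of_lt {k : ℕ} {ι : Type*} (v : Fin k × ι → ℤ) {i : ℕ} (h : i < k) :
    blockExtend v i = fun b => v (⟨i, h⟩, b) := by
  simp [blockExtend, h]

theorem blockExtend_of_le {k : ℕ} {ι : Type*} (v : Fin k × ι → ℤ) {i : ℕ} (h : k ≤ i) :
    blockExtend v i = 0 := by
  simp [blockExtend, Nat.not_lt.2 h]

/-- The last value of forward substitution started at zero, as a homomorphism. -/
def forwardSubstHom {ι : Type*} [Fintype ι] (A : ℕ → Matrix ι ι ℤ) (k : ℕ) :
    (Fin k × ι → ℤ) →+ (ι → ℤ) :=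
  AddMonoidHom.mk' (fun v => forwardSubst A 0 (blockExtend v) k) fun v w => by
    rw [blockExtend_add, ← forwardSubst_add, add_zero]

theorem forwardSubstHom_surjective {ι : Type*} [Fintype ι] (A : ℕ → Matrix ι ι ℤ) {k : ℕ}
    (hk : 0 < k) : Function.Surjective (forwardSubstHom A k) := by
  intro x
  obtain ⟨m, rfl⟩ : ∃ m, k = m + 1 := ⟨k - 1, by omega⟩
  refine ⟨fun p => if (p.1 : ℕ) = m then x p.2 else 0, ?_⟩
  set v : Fin (m + 1) × ι → ℤ := fun p => if (p.1 : ℕ) = m then x p.2 else 0 with hv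
  have hlt : ∀ i < m, blockExtend v i = 0 := by
    intro i hi
    funext b
    rw [blockExtend_of_lt v (Nat.lt_succ_of_lt hi)]
    simp [hv, hi.ne]
  have hzero : ∀ j ≤ m, (0 : ι → ℤ) = forwardSubst A 0 (blockExtend v) j :=
    eq_forwardSubst A (blockExtend v) (fun _ => 0) m fun i hi => by simp [hlt i hi]
  change forwardSubst A 0 (blockExtend v) (m + 1) = x
  rw [forwardSubst, ← hzero m le_rfl, blockExtend_of_lt v (Nat.lt_succ_self m)]
  simp [hv]

theorem vecMul_block_lower_bidiagonal {n k : ℕ} (A : ℕ → Matrix (Fin n) (Fin n) ℤ)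
    (C : Matrix (Fin k × Fin n) (Fin k × Fin n) ℤ)
    (hC : ∀ p q : Fin k × Fin n,
      C p q =
        if p.1 = q.1 then A p.1 p.2 q.2
        else if (p.1 : ℕ) = (q.1 : ℕ) + 1 then (if p.2 = q.2 then 1 else 0)
        else 0)
    (w : Fin k × Fin n → ℤ) {i : ℕ} (hi : i < k) :
    blockExtend (Matrix.vecMul w C) i =
      Matrix.vecMul (blockExtend w i) (A i) + blockExtend w (i + 1) := by
  have hsplit : ∀ (a : Fin k) (c b : Fin n), w (a, c) * C (a, c) (⟨i, hi⟩, b) =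
      (if a = ⟨i, hi⟩ then w (a, c) * A a c b else 0) +
        (if (a : ℕ) = i + 1 then (if c = b then w (a, c) else 0) else 0) := by
    intro a c b
    rw [hC]
    by_cases h : a = ⟨i, hi⟩
    · subst h
      simp
    · by_cases h' : (a : ℕ) = i + 1 <;> simp [h, h']
  funext b
  rw [blockExtend_of_lt _ hi, blockExtend_of_lt w hi, Pi.add_apply]
  simp only [Matrix.vecMul, dotProduct, Fintype.sum_prod_type, hsplit, Finset.sum_add_distrib]
  congr 1
  · rw [Finset.sum_eq_single ⟨i, hi⟩] <;> simp +contextual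
  · by_cases h : i + 1 < k
    · rw [blockExtend_of_lt w h, Finset.sum_eq_single ⟨i + 1, h⟩]
      · simp
      · intro a _ ha
        have : (a : ℕ) ≠ i + 1 := fun h' => ha (Fin.ext h')
        simp [this]
      · simp
    · rw [blockExtend_of_le w (by omega)]
      refine Finset.sum_eq_zero fun a _ => ?_
      have : (a : ℕ) ≠ i + 1 := by omega
      simp [this]

theorem exists_vecMul_eq_iff_forwardSubst {n k : ℕ} (A : ℕ → Matrix (Fin n) (Fin n) ℤ)
    (C : Matrix (Fin k × Fin n) (Fin k × Fin n) ℤ)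
    (hC : ∀ p q : Fin k × Fin n,
      C p q =
        if p.1 = q.1 then A p.1 p.2 q.2
        else if (p.1 : ℕ) = (q.1 : ℕ) + 1 then (if p.2 = q.2 then 1 else 0)
        else 0)
    (v : Fin k × Fin n → ℤ) :
    (∃ w, Matrix.vecMul w C = v) ↔ ∃ z, forwardSubst A z (blockExtend v) k = 0 := by
  constructor
  · rintro ⟨w, rfl⟩
    refine ⟨blockExtend w 0, ?_⟩
    rw [← eq_forwardSubst A _ (blockExtend w) k
      (fun i hi => (vecMul_block_lower_bidiagonal A C hC w hi).symm) k le_rfl,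
      blockExtend_of_le w le_rfl]
  · rintro ⟨z, hz⟩
    set u := forwardSubst A z (blockExtend v) with hu
    let w : Fin k × Fin n → ℤ := fun p => u p.1 p.2
    have hw : ∀ i ≤ k, blockExtend w i = u i := by
      intro i hi
      rcases hi.lt_or_eq with h | rfl
      · rw [blockExtend_of_lt w h]
      · rw [blockExtend_of_le w le_rfl, hz]
    refine ⟨w, funext fun ⟨i, b⟩ => ?_⟩
    have h := vecMul_block_lower_bidiagonal A C hC w i.2
    rw [hw i i.2.le, hw (i + 1) i.2, hu, forwardSubst, add_sub_cancel,
      blockExtend_of_lt _ i.2, blockExtend_of_lt _ i.2] at h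
    exact congrFun h b

/-- For the block lower bidiagonal matrix `C` with diagonal blocks
`A 1, …, A k` and identity blocks on the subdiagonal, the cokernel of `C` is isomorphic,
as an abelian group, to the cokernel of the product `A 1 * A 2 * ⋯ * A k`. -/
theorem cok_block_lower_bidiagonal_iso_cok_prod
    (n k : ℕ) (hn : 0 < n) (hk : 0 < k)
    (A : Fin k → Matrix (Fin n) (Fin n) ℤ)
    (C : Matrix (Fin k × Fin n) (Fin k × Fin n) ℤ)
    (hC : ∀ p q : Fin k × Fin n,
      C p q =
        if p.1 = q.1 then A p.1 p.2 q.2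
        else if (p.1 : ℕ) = (q.1 : ℕ) + 1 then (if p.2 = q.2 then 1 else 0)
        else 0) :
    Nonempty (cok C ≃+ cok ((List.finRange k).map A).prod) := by
  let B : ℕ → Matrix (Fin n) (Fin n) ℤ := fun i => if h : i < k then A ⟨i, h⟩ else 0
  have hB : ∀ i : Fin k, B i = A i := fun i => by simp [B]
  have hprod : ((List.finRange k).map A).prod = ((List.range k).map B).prod := by
    rw [← List.map_coe_finRange_eq_range, List.map_map]
    congr 2
    funext i
    exact (hB i).symm
  rw [hprod]
  set P := ((List.range k).map B).prod with hP
  let f : (Fin k × Fin n → ℤ) →+ cok P :=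
    (QuotientAddGroup.mk' _).comp (forwardSubstHom B k)
  have hf : Function.Surjective f :=
    (QuotientAddGroup.mk'_surjective _).comp (forwardSubstHom_surjective B hk)
  have hker : AddSubgroup.closure (Set.range fun i => C i) = f.ker := by
    ext v
    rw [mem_closure_range_rows_iff,
      exists_vecMul_eq_iff_forwardSubst B C (fun p q => by rw [hC, hB]) v, AddMonoidHom.mem_ker]
    change _ ↔ ((forwardSubst B 0 (blockExtend v) k : Fin n → ℤ) : cok P) = 0
    rw [QuotientAddGroup.eq_zero_iff, mem_closure_range_rows_iff]
    have hsign : (-1 : ℤ) ^ k * (-1) ^ k = 1 := by rw [← mul_pow]; simp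
    constructor
    · rintro ⟨z, hz⟩
      rw [forwardSubst_eq, ← hP] at hz
      exact ⟨-((-1 : ℤ) ^ k • z), by
        rw [Matrix.neg_vecMul, eq_neg_of_add_eq_zero_left hz]⟩
    · rintro ⟨z, hz⟩
      refine ⟨-((-1 : ℤ) ^ k • z), ?_⟩
      rw [forwardSubst_eq, ← hP, ← hz, smul_neg, smul_smul, hsign, one_smul, Matrix.neg_vecMul,
        add_neg_cancel]
  exact ⟨(QuotientAddGroup.quotientAddEquivOfEq hker).trans
    (QuotientAddGroup.quotientKerEquivOfSurjective f hf)⟩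

end
end

section
/- Let G be a finite abelian group, let Sg(G) denote the set of subgroups of G, and let k ≥ 1 and i ≥ 0 be integers. Then |{H ∈ Sg(G)^k : w(H) = 0 and t(H) = i}| = c(G,i)·C(k,i), where C(k,i) is the binomial coefficient. -/
open scoped Classical

noncomputable section

/-- The predecessor of `H i` in a sequence of subgroups, with the convention `H₀ = ⊥`. -/
def prevSub {G : Type*} [AddCommGroup G] {k : ℕ} (H : Fin k → AddSubgroup G) (i : Fin k) :
    AddSubgroup G :=
  if _ : (i : ℕ) = 0 then ⊥ else H ⟨(i : ℕ) - 1, lt_of_le_of_lt (Nat.pred_le _) i.isLt⟩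

/-- `w(H)`: the number of indices `i ∈ {2,…,k}` (1-based) with `H_{i−1} ⊄ H_i`. -/
def wOf {G : Type*} [AddCommGroup G] {k : ℕ} (H : Fin k → AddSubgroup G) : ℕ :=
  Set.ncard {i : Fin k | (i : ℕ) ≠ 0 ∧ ¬ prevSub H i ≤ H i}

/-- `t(H)`: the number of indices `i ∈ {1,…,k}` (1-based) with `H_{i−1} ⊊ H_i`, `H₀ = {0}`. -/
def tOf {G : Type*} [AddCommGroup G] {k : ℕ} (H : Fin k → AddSubgroup G) : ℕ :=
  Set.ncard {i : Fin k | prevSub H i < H i}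

/-- `c(G,i)`: the number of chains of subgroups `{0} ⊊ H₁ ⊊ ⋯ ⊊ H_i ⊆ G`. -/
def chainCount (G : Type*) [AddCommGroup G] (i : ℕ) : ℕ :=
  Nat.card {H : Fin i → AddSubgroup G // ∀ j, prevSub H j < H j}

/-- The predecessor of `H i` in the sequence `a, H 0, H 1, …`. -/
def prevFrom {α : Type*} (a : α) {k : ℕ} (H : Fin k → α) (i : Fin k) : α :=
  (Fin.cons a H : Fin (k + 1) → α) i.castSucc

lemma prevFrom_cons_zero {α : Type*} (a b : α) {k : ℕ} (H : Fin k → α) :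
    prevFrom a (Fin.cons b H : Fin (k + 1) → α) 0 = a := rfl

lemma prevFrom_cons_succ {α : Type*} (a b : α) {k : ℕ} (H : Fin k → α) (i : Fin k) :
    prevFrom a (Fin.cons b H : Fin (k + 1) → α) i.succ = prevFrom b H i := by
  simp only [prevFrom, ← Fin.succ_castSucc, Fin.cons_succ]

lemma prevSub_eq_prevFrom {G : Type*} [AddCommGroup G] {k : ℕ} (H : Fin k → AddSubgroup G)
    (i : Fin k) : prevSub H i = prevFrom ⊥ H i := by
  obtain ⟨i, hi⟩ := i
  cases i with
  | zero => rfl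
  | succ i => rfl

lemma card_filter_pi_succ {α : Type*} [Fintype α] {k : ℕ} (p : (Fin (k + 1) → α) → Prop)
    [DecidablePred p] :
    Finset.card {H | p H} = ∑ b : α, Finset.card {H : Fin k → α | p (Fin.cons b H)} := by
  simp only [Finset.card_filter]
  rw [← (Fin.consEquiv fun _ : Fin (k + 1) => α).sum_comp, Fintype.sum_prod_type]
  rfl

section Chains

variable {α : Type*} [PartialOrder α] [Fintype α]

/-- The number of strict chains `a < H 0 < ⋯ < H (n - 1)`. -/
def strictCount (a : α) (n : ℕ) : ℕ :=
  Finset.card {H : Fin n → α | ∀ i, prevFrom a H i < H i}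

/-- The number of weak chains `a ≤ H 0 ≤ ⋯ ≤ H (k - 1)` with exactly `n` strict steps. -/
def weakCount (a : α) (k n : ℕ) : ℕ :=
  Finset.card {H : Fin k → α | (∀ i, prevFrom a H i ≤ H i) ∧
    Finset.card {i | prevFrom a H i < H i} = n}

lemma strictCount_zero (a : α) : strictCount a 0 = 1 := by
  simp [strictCount]

lemma strictCount_succ (a : α) (n : ℕ) :
    strictCount a (n + 1) = ∑ b with a < b, strictCount b n := by
  rw [strictCount, card_filter_pi_succ, Finset.sum_filter]
  refine Finset.sum_congr rfl fun b _ => ?_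
  simp only [Fin.forall_fin_succ, prevFrom_cons_zero, prevFrom_cons_succ, Fin.cons_zero,
    Fin.cons_succ]
  split_ifs with h <;> simp [h, strictCount]

lemma weakCount_zero (a : α) (n : ℕ) : weakCount a 0 n = if n = 0 then 1 else 0 := by
  cases n <;> simp [weakCount]

lemma weakCount_succ_eq_sum (a : α) (k n : ℕ) :
    weakCount a (k + 1) n = ∑ b, if a ≤ b then Finset.card {H : Fin k → α |
      (∀ i, prevFrom b H i ≤ H i) ∧
        (if a < b then 1 else 0) + Finset.card {i | prevFrom b H i < H i} = n} else 0 := by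
  rw [weakCount, card_filter_pi_succ]
  refine Finset.sum_congr rfl fun b _ => ?_
  simp only [Fin.forall_fin_succ, Finset.card_filter, Fin.sum_univ_succ, prevFrom_cons_zero,
    prevFrom_cons_succ, Fin.cons_zero, Fin.cons_succ]
  by_cases h : a ≤ b <;> simp [h]

lemma weakCount_succ_zero (a : α) (k : ℕ) : weakCount a (k + 1) 0 = weakCount a k 0 := by
  rw [weakCount_succ_eq_sum, Finset.sum_eq_single a]
  · simp [weakCount]
  · intro b _ hb
    split_ifs with h h'
    · simp
    · exact absurd (lt_of_le_of_ne h hb.symm) h'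
    · rfl
  · simp

lemma weakCount_succ_succ (a : α) (k n : ℕ) :
    weakCount a (k + 1) (n + 1) = weakCount a k (n + 1) + ∑ b with a < b, weakCount b k n := by
  rw [weakCount_succ_eq_sum, Finset.sum_filter, ← Finset.add_sum_erase _ _ (Finset.mem_univ a),
    ← Finset.add_sum_erase (a := a) Finset.univ (fun b => if a < b then weakCount b k n else 0)
      (Finset.mem_univ a)]
  simp only [le_refl, lt_irrefl, if_true, if_false, zero_add]
  congr 1
  refine Finset.sum_congr rfl fun b hb => ?_
  have hab : a ≤ b ↔ a < b := ⟨fun h => lt_of_le_of_ne h (Finset.ne_of_mem_erase hb).symm, le_of_lt⟩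
  simp only [hab]
  split_ifs
  · simp only [weakCount, add_comm 1, add_left_inj]
  · rfl

theorem weakCount_eq (a : α) (k n : ℕ) : weakCount a k n = strictCount a n * k.choose n := by
  induction k generalizing a n with
  | zero => cases n <;> simp [weakCount_zero, strictCount_zero]
  | succ k ih =>
    cases n with
    | zero => simp [weakCount_succ_zero, ih]
    | succ n =>
      simp only [weakCount_succ_succ, ih]
      rw [← Finset.sum_mul, ← strictCount_succ, Nat.choose_succ_succ]
      ring

end Chains

lemma wOf_eq_zero_iff {G : Type*} [AddCommGroup G] {k : ℕ} (H : Fin k → AddSubgroup G) :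
    wOf H = 0 ↔ ∀ i, prevFrom ⊥ H i ≤ H i := by
  rw [wOf, Set.ncard_eq_zero (Set.toFinite _), Set.eq_empty_iff_forall_notMem]
  refine forall_congr' fun i => ?_
  rw [Set.mem_ofPred_eq, ← prevSub_eq_prevFrom, not_and_not_right]
  refine ⟨fun h => ?_, fun h _ => h⟩
  by_cases hi : (i : ℕ) = 0
  · simp [prevSub, hi]
  · exact h hi

lemma tOf_eq_card {G : Type*} [AddCommGroup G] {k : ℕ} (H : Fin k → AddSubgroup G) :
    tOf H = Finset.card {i | prevFrom ⊥ H i < H i} := by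
  simp only [tOf, prevSub_eq_prevFrom, Set.ncard_eq_toFinset_card', Set.toFinset_ofPred]

/-- For `k ≥ 1` and `i ≥ 0`,
`|{H ∈ Sg(G)^k : w(H)=0 and t(H)=i}| = c(G,i)·C(k,i)`. -/
theorem card_tuples_wOf_zero_tOf_eq
    (G : Type) [AddCommGroup G] [Fintype G] (k i : ℕ) (hk : 1 ≤ k) :
    Nat.card {H : Fin k → AddSubgroup G // wOf H = 0 ∧ tOf H = i} =
      chainCount G i * k.choose i := by
  simp only [wOf_eq_zero_iff, tOf_eq_card, chainCount, prevSub_eq_prevFrom,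
    Nat.card_eq_fintype_card, Fintype.card_subtype]
  exact weakCount_eq ⊥ k i

end
end
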